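/- Let $T \in \mathfrak{P}_n$ be a contracting transducer with at least one completion in the homeomorphism group of $\mathfrak{C}_n$. Then $\mathcal{H}(T) = \mathcal{F}(T)$: every homeomorphism of $\mathfrak{C}_n$ that locally agrees with $\mathcal{H}(T)$ is itself a completion of $T$, hence lies in $\mathcal{H}(T)$. -/

import Mathlib

open Classical

noncomputable section

/-- `n`-ary Cantor space: infinite words over the alphabet `Fin n`. -/
abbrev Cantor (n : ℕ) : Type := ℕ → Fin n

/-- The finite word `w` is a prefix of the infinite word `χ`. -/
def PrefixOf {n : ℕ} (w : List (Fin n)) (χ : Cantor n) : Prop :=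
  ∀ (i : ℕ) (h : i < w.length), w.get ⟨i, h⟩ = χ i

/-- Concatenation of a finite word with an infinite word. -/
def appendInf {n : ℕ} (w : List (Fin n)) (χ : Cantor n) : Cantor n :=
  fun i => if h : i < w.length then w.get ⟨i, h⟩ else χ (i - w.length)

/-- The cone (basic clopen set) of infinite words having the finite word `w` as prefix. -/
def cone {n : ℕ} (w : List (Fin n)) : Set (Cantor n) :=
  {χ | PrefixOf w χ}

/-- The length-`k` prefix of an infinite word, as a finite word. -/
def takeW {n : ℕ} (χ : Cantor n) (k : ℕ) : List (Fin n) :=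
  List.ofFn (fun i : Fin k => χ i)

/-- A finite family of finite words forming a maximal antichain:
every infinite word has exactly one member of the family as a prefix. -/
def AntichainFam {n m : ℕ} (α : Fin m → List (Fin n)) : Prop :=
  ∀ χ : Cantor n, ∃! i : Fin m, PrefixOf (α i) χ

/-- The group structure on self-homeomorphisms of a topological space,
with `f * g` acting as `g` followed by `f`. -/
instance homeoGroup {X : Type*} [TopologicalSpace X] : Group (X ≃ₜ X) where
  mul f g := g.trans f
  one := Homeomorph.refl X
  inv := Homeomorph.symm
  mul_assoc a b c := Homeomorph.ext fun _ => rfl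
  one_mul a := Homeomorph.ext fun _ => rfl
  mul_one a := Homeomorph.ext fun _ => rfl
  inv_mul_cancel a := Homeomorph.ext fun x => a.symm_apply_apply x

/-- The Higman–Thompson group `Vₙ`, as the set of self-homeomorphisms of Cantor space
which act by exchanging finite prefixes along a pair of maximal antichains. -/
def Vn (n : ℕ) : Set (Cantor n ≃ₜ Cantor n) :=
  {g | ∃ (m : ℕ) (α β : Fin m → List (Fin n)), AntichainFam α ∧ AntichainFam β ∧
      ∀ (i : Fin m) (χ : Cantor n), g (appendInf (α i) χ) = appendInf (β i) χ}

/-- Conjugation in the paper's right-action convention: `paperConj g v = g⁻¹ v g`,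
i.e. the homeomorphism `x ↦ (x) g⁻¹ v g` (first apply `g⁻¹`, then `v`, then `g`). -/
def paperConj {n : ℕ} (g v : Cantor n ≃ₜ Cantor n) : Cantor n ≃ₜ Cantor n :=
  (g.symm.trans v).trans g

/-- `l` is the longest common prefix of the set `A` of infinite words. -/
def IsLCP {n : ℕ} (A : Set (Cantor n)) (l : List (Fin n)) : Prop :=
  (∀ ρ ∈ A, PrefixOf l ρ) ∧
    ∀ l' : List (Fin n), (∀ ρ ∈ A, PrefixOf l' ρ) → l'.length ≤ l.length

/-- A (not necessarily finite-state) transducer over the alphabet `Fin n`. -/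
structure Transducer (n : ℕ) where
  /-- the set of states -/
  Q : Type
  /-- the transition function -/
  tr : Fin n → Q → Q
  /-- the output (rewrite) function -/
  out : Fin n → Q → List (Fin n)

namespace Transducer

variable {n : ℕ}

/-- The transition function extended to finite words. -/
def transStar (T : Transducer n) : List (Fin n) → T.Q → T.Q
  | [], q => q
  | x :: w, q => T.transStar w (T.tr x q)

/-- The output function extended to finite words. -/
def outStar (T : Transducer n) : List (Fin n) → T.Q → List (Fin n)
  | [], _ => []
  | x :: w, q => T.out x q ++ T.outStar w (T.tr x q)

/-- The initial transducer `T_q` induces the map `f` on Cantor space: the outputs along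
ever longer prefixes of `χ` are ever longer prefixes of `f χ`. -/
def Induces (T : Transducer n) (q : T.Q) (f : Cantor n → Cantor n) : Prop :=
  ∀ (χ : Cantor n) (m : ℕ), ∃ k : ℕ,
    m ≤ (T.outStar (takeW χ k) q).length ∧ PrefixOf (T.outStar (takeW χ k) q) (f χ)

/-- The image of the state `q`: the image of Cantor space under the map induced by `T_q`. -/
def stateImage (T : Transducer n) (q : T.Q) : Set (Cantor n) :=
  {y | ∃ (f : Cantor n → Cantor n) (χ : Cantor n), T.Induces q f ∧ f χ = y}

/-- `T` is synchronizing at level `k`: the state reached after reading any word of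
length `k` does not depend on the starting state. -/
def SyncAtLevel (T : Transducer n) (k : ℕ) : Prop :=
  ∀ w : List (Fin n), w.length = k → ∀ q q' : T.Q, T.transStar w q = T.transStar w q'

/-- `T` is synchronizing if it is synchronizing at some level. -/
def Synchronizing (T : Transducer n) : Prop := ∃ k, T.SyncAtLevel k

/-- `T` (inducing the homeomorphism `h` at `q0`) is one-way synchronizing: `T` is
synchronizing, but the inverse homeomorphism is not induced by any finite
synchronizing transducer (equivalently, the inverse transducer is not synchronizing). -/
def OneWaySync (T : Transducer n) (q0 : T.Q) (h : Cantor n ≃ₜ Cantor n) : Prop :=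
  T.Induces q0 ⇑h ∧ T.Synchronizing ∧
    ¬ ∃ (S : Transducer n) (_ : Finite S.Q) (s0 : S.Q),
        S.Induces s0 ⇑h.symm ∧ S.Synchronizing

/-- `T` is equal to its core : every state is reached by reading a word of length `k`
from some state, for every synchronizing level `k`. -/
def EqualToCore (T : Transducer n) : Prop :=
  ∀ k : ℕ, T.SyncAtLevel k → ∀ q : T.Q, ∃ (w : List (Fin n)) (p : T.Q),
    w.length = k ∧ T.transStar w p = q

/-- Every state of `T` is accessible from `q0`. -/
def Accessible (T : Transducer n) (q0 : T.Q) : Prop :=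
  ∀ q : T.Q, ∃ w : List (Fin n), T.transStar w q0 = q

/-- The product transducer `T S` (first act by `T`, then by `S`). -/
def prod (T S : Transducer n) : Transducer n where
  Q := T.Q × S.Q
  tr := fun x p => (T.tr x p.1, S.transStar (T.out x p.1) p.2)
  out := fun x p => S.outStar (T.out x p.1) p.2

/-- `T` is partially invertible: every state induces an injective map on Cantor space
with clopen image. -/
def PartiallyInvertible (T : Transducer n) : Prop :=
  ∀ q : T.Q, ∃ f : Cantor n → Cantor n,
    T.Induces q f ∧ Function.Injective f ∧ IsClopen (Set.range f)

/-- `T` has no states of incomplete response: for each state `q` and letter `i`, no word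
strictly longer than `λ(i,q)` is a common prefix of the outputs on all of the cone `[i]`. -/
def NoIncompleteResponse (T : Transducer n) : Prop :=
  ∀ (q : T.Q) (i x : Fin n),
    ¬ ∀ χ : Cantor n, ∃ k : ℕ, (T.out i q ++ [x]) <+: T.outStar (i :: takeW χ k) q

/-- States `q` of `T` and `p` of `S` are `ω`-equivalent: they induce one and the same
map on Cantor space. -/
def OmegaEq (T : Transducer n) (q : T.Q) (S : Transducer n) (p : S.Q) : Prop :=
  ∃ f : Cantor n → Cantor n, T.Induces q f ∧ S.Induces p f

/-- `T` is minimal: no states of incomplete response and no pair of distinct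
`ω`-equivalent states. -/
def Minimal (T : Transducer n) : Prop :=
  T.NoIncompleteResponse ∧ ∀ q q' : T.Q, T.OmegaEq q T q' → q = q'

/-- The map on Cantor space induced by the state `q` (junk value if none exists). -/
def inducedMap (T : Transducer n) (q : T.Q) : Cantor n → Cantor n :=
  if h : ∃ f, T.Induces q f then h.choose else id

/-- `𝓛_q(α)`: the longest common prefix of the preimage of the cone `[α]` under `T_q`
(junk value if it does not exist). -/
def lcp (T : Transducer n) (q : T.Q) (α : List (Fin n)) : List (Fin n) :=
  if h : ∃ l, IsLCP {ρ : Cantor n | T.inducedMap q ρ ∈ cone α} l then h.choose else []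

/-- The inverse transducer of `T` given by the inversion algorithm, on the set of all
pairs `(w, q)`: reading `x` from `(w,q)` outputs `𝓛_q(wx)` and moves to
`(wx - λ(𝓛_q(wx), q), π(𝓛_q(wx), q))`. -/
def invT (T : Transducer n) : Transducer n where
  Q := List (Fin n) × T.Q
  tr := fun x p =>
    ((p.1 ++ [x]).drop (T.outStar (T.lcp p.2 (p.1 ++ [x])) p.2).length,
      T.transStar (T.lcp p.2 (p.1 ++ [x])) p.2)
  out := fun x p => T.lcp p.2 (p.1 ++ [x])

/-- Restriction of a transducer to a set of states (transitions leaving the set are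
replaced by junk loops; for transition-closed sets this is the honest restriction). -/
def restrictTo (T : Transducer n) (P : T.Q → Prop) : Transducer n where
  Q := {q : T.Q // P q}
  tr := fun x q => if h : P (T.tr x q.1) then ⟨T.tr x q.1, h⟩ else q
  out := fun x q => T.out x q.1

/-- The set of states reachable from `q0`. -/
def reach (T : Transducer n) (q0 : T.Q) : T.Q → Prop :=
  fun q => ∃ w : List (Fin n), T.transStar w q0 = q

/-- The inverse transducer of the initial transducer `T_{q0}`, with state set the states
accessible from `(ε, q0)`. -/
def invAcc (T : Transducer n) (q0 : T.Q) : Transducer n :=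
  (T.invT).restrictTo ((T.invT).reach ([], q0))

/-- A pair `(w,p)` is good if `[w] ⊆ im(T_p)` and `𝓛_p(w) = ε`. -/
def GoodPair (T : Transducer n) (p : List (Fin n) × T.Q) : Prop :=
  cone p.1 ⊆ T.stateImage p.2 ∧
    IsLCP {ρ : Cantor n | T.inducedMap p.2 ρ ∈ cone p.1} []

/-- The partial inverse `T'` of a partially invertible transducer `T`: the inverse
transducer restricted to the good pairs `(w,p)` with `[w] ⊆ im(T_p)`, `𝓛_p(w) = ε`. -/
def partialInv (T : Transducer n) : Transducer n :=
  (T.invT).restrictTo T.GoodPair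

/-- `h` is a completion of `T`: there are a maximal antichain `η` and an effective viable
combination `(ρ, p)` such that `h` maps `η_i χ` to `ρ_i (χ)T_{p_i}`. -/
def IsCompletion (T : Transducer n) (h : Cantor n ≃ₜ Cantor n) : Prop :=
  ∃ (l : ℕ) (η ρ : Fin l → List (Fin n)) (p : Fin l → T.Q)
      (f : Fin l → (Cantor n → Cantor n)),
    l % (n - 1) = 1 % (n - 1) ∧
    AntichainFam η ∧
    (∀ i, T.Induces (p i) (f i)) ∧
    (⋃ i, appendInf (ρ i) '' Set.range (f i)) = Set.univ ∧
    (∀ i j, i ≠ j →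
      Disjoint (appendInf (ρ i) '' Set.range (f i))
        (appendInf (ρ j) '' Set.range (f j))) ∧
    ∀ (i : Fin l) (χ : Cantor n), h (appendInf (η i) χ) = appendInf (ρ i) (f i χ)

/-- The group `𝓗(T)` generated by all completions of `T`. -/
def HGroup (T : Transducer n) : Subgroup (Cantor n ≃ₜ Cantor n) :=
  Subgroup.closure {h | T.IsCompletion h}

/-- The subgroup-generating equivalence relation induced by the automaton underlying a
transducer `A` with start state `a0` (by Lemma 4.1, two words are related iff the states
they reach are identified by the collapsing procedure, i.e. iff the reached states
transition identically on all sufficiently long words). -/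
def simA (A : Transducer n) (a0 : A.Q) (α β : List (Fin n)) : Prop :=
  ∃ i : ℕ, ∀ w : List (Fin n), w.length = i →
    A.transStar w (A.transStar α a0) = A.transStar w (A.transStar β a0)

/-- `if b then T else T'`. -/
def factor (T : Transducer n) (b : Bool) : Transducer n :=
  if b then T else T.partialInv

/-- The product of a nonempty list of factors, each equal to `T` or its partial
inverse `T'`; these products make up the set `Π(T)`. -/
def prodOf (T : Transducer n) : List Bool → Transducer n
  | [] => T
  | [b] => T.factor b
  | b :: c :: rest => (T.factor b).prod (T.prodOf (c :: rest))

/-- `T` is contracting: every state of every product of copies of `T` and `T'` is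
`ω`-equivalent to an initial transducer which, after reading some fixed length of input,
always acts as a state of `T`. -/
def Contracting (T : Transducer n) : Prop :=
  ∀ L : List Bool, L ≠ [] → ∀ q : (T.prodOf L).Q,
    ∃ (V : Transducer n) (p : V.Q) (f : Cantor n → Cantor n),
      (T.prodOf L).Induces q f ∧ V.Induces p f ∧
      ∃ j : ℕ, ∀ w : List (Fin n), w.length = j →
        ∃ (u : T.Q) (g : Cantor n → Cantor n),
          V.Induces (V.transStar w p) g ∧ T.Induces u g

end Transducer

/-- The element `v` of `Vₙ` preserves the relation `r` on nonempty finite words: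
whenever `v` replaces the prefix `α` by `β`, the words `α` and `β` are related. -/
def PreservesRel {n : ℕ} (r : List (Fin n) → List (Fin n) → Prop)
    (g : Cantor n ≃ₜ Cantor n) : Prop :=
  ∀ (α β : List (Fin n)), α ≠ [] → β ≠ [] →
    (∀ χ : Cantor n, g (appendInf α χ) = appendInf β χ) → r α β

/-- The subgroup `V_∼` of `Vₙ` generated by the prefix-exchange homeomorphisms
preserving the relation `r`. -/
def VSim (n : ℕ) (r : List (Fin n) → List (Fin n) → Prop) :
    Subgroup (Cantor n ≃ₜ Cantor n) :=
  Subgroup.closure {g | g ∈ Vn n ∧ PreservesRel r g}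

/-- `f` coincides with `g` on the cone `[α]` (conjugated into the cone) and is the
identity off the cone: the homeomorphism `[α]_g`. -/
def IsRestrTo {n : ℕ} (α : List (Fin n)) (g f : Cantor n ≃ₜ Cantor n) : Prop :=
  (∀ χ : Cantor n, f (appendInf α χ) = appendInf α (g χ)) ∧
  ∀ χ : Cantor n, ¬ PrefixOf α χ → f χ = χ

/-- The Nekrashevych group `Vₙ(G)`: the group generated by `Vₙ` together with all the
homeomorphisms `[α]_g` for `g ∈ G`. -/
def NekG (n : ℕ) (G : Subgroup (Cantor n ≃ₜ Cantor n)) :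
    Subgroup (Cantor n ≃ₜ Cantor n) :=
  Subgroup.closure (Vn n ∪ {f | ∃ (α : List (Fin n)) (g : Cantor n ≃ₜ Cantor n),
    g ∈ G ∧ IsRestrTo α g f})

/-- The homeomorphism `f` locally agrees with the set `G` of homeomorphisms. -/
def LocallyAgrees {n : ℕ} (G : Set (Cantor n ≃ₜ Cantor n))
    (f : Cantor n ≃ₜ Cantor n) : Prop :=
  ∀ x : Cantor n, ∃ U : Set (Cantor n), IsOpen U ∧ x ∈ U ∧
    ∃ g ∈ G, Set.EqOn ⇑f ⇑g U

/-- A finite synchronous invertible transducer over `Fin n`: each state rewrites single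
letters to single letters bijectively. -/
structure SyncTransducer (n : ℕ) where
  /-- the set of states -/
  Q : Type
  /-- there are finitely many states -/
  fin : Finite Q
  /-- the transition function -/
  tr : Fin n → Q → Q
  /-- the (single-letter) output function -/
  out : Fin n → Q → Fin n
  /-- each state rewrites letters bijectively -/
  bij : ∀ q : Q, Function.Bijective fun x => out x q

namespace SyncTransducer

variable {n : ℕ}

/-- The transition function extended to finite words. -/
def trStar (U : SyncTransducer n) : List (Fin n) → U.Q → U.Q
  | [], q => q
  | x :: w, q => U.trStar w (U.tr x q)

/-- The output function extended to finite words. -/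
def outWord (U : SyncTransducer n) : List (Fin n) → U.Q → List (Fin n)
  | [], _ => []
  | x :: w, q => U.out x q :: U.outWord w (U.tr x q)

/-- The map on Cantor space induced by the initial transducer `U_q`. -/
def applyFun (U : SyncTransducer n) (q : U.Q) (χ : Cantor n) : Cantor n :=
  fun i => U.out (χ i) (U.trStar (takeW χ i) q)

/-- The inverse transducer of a synchronous invertible transducer. -/
def inv (U : SyncTransducer n) : SyncTransducer n where
  Q := U.Q
  fin := U.fin
  tr := fun y q => U.tr ((Equiv.ofBijective _ (U.bij q)).symm y) q
  out := fun y q => (Equiv.ofBijective _ (U.bij q)).symm y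
  bij := fun q => (Equiv.ofBijective _ (U.bij q)).symm.bijective

/-- The product of synchronous transducers (first act by `T`, then by `S`). -/
def sprod (T S : SyncTransducer n) : SyncTransducer n where
  Q := T.Q × S.Q
  fin := by
    haveI := T.fin; haveI := S.fin
    infer_instance
  tr := fun x p => (T.tr x p.1, S.tr (T.out x p.1) p.2)
  out := fun x p => S.out (T.out x p.1) p.2
  bij := fun p => (S.bij p.2).comp (T.bij p.1)

/-- `U` is synchronizing at level `k`. -/
def SyncAtLevel (U : SyncTransducer n) (k : ℕ) : Prop :=
  ∀ w : List (Fin n), w.length = k → ∀ q q' : U.Q, U.trStar w q = U.trStar w q'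

/-- `U` is synchronizing. -/
def Synchronizing (U : SyncTransducer n) : Prop := ∃ k, U.SyncAtLevel k

/-- `U` is minimal (under `ω`-equivalence): distinct states induce distinct maps. -/
def Minimal (U : SyncTransducer n) : Prop :=
  ∀ q q' : U.Q, U.applyFun q = U.applyFun q' → q = q'

/-- One-way synchronizing: `U` is synchronizing but the inverse homeomorphism of
`h = U_{q0}` is not induced by any finite synchronizing transducer. -/
def OneWaySync (U : SyncTransducer n) (h : Cantor n ≃ₜ Cantor n) : Prop :=
  U.Synchronizing ∧
    ¬ ∃ (S : Transducer n) (_ : Finite S.Q) (s0 : S.Q),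
        S.Induces s0 ⇑h.symm ∧ S.Synchronizing

/-- `U` is equal to its core. -/
def EqualToCore (U : SyncTransducer n) : Prop :=
  ∀ k : ℕ, U.SyncAtLevel k → ∀ q : U.Q, ∃ (w : List (Fin n)) (p : U.Q),
    w.length = k ∧ U.trStar w p = q

/-- The underlying (asynchronous-format) transducer of a synchronous transducer. -/
def toT (U : SyncTransducer n) : Transducer n :=
  ⟨U.Q, U.tr, fun x q => [U.out x q]⟩

/-- The automaton group `𝒢(U)` generated by `U`: the subgroup of the homeomorphism
group of Cantor space generated by the homeomorphisms `U_q` for the states `q`. -/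
def autG (U : SyncTransducer n) : Subgroup (Cantor n ≃ₜ Cantor n) :=
  Subgroup.closure {f : Cantor n ≃ₜ Cantor n | ∃ q : U.Q, ⇑f = U.applyFun q}

end SyncTransducer

section Words

variable {n : ℕ}

theorem length_takeW (χ : Cantor n) (k : ℕ) : (takeW χ k).length = k := by
  simp [takeW]

theorem getElem_takeW (χ : Cantor n) (k i : ℕ) (h : i < (takeW χ k).length) :
    (takeW χ k)[i] = χ i := by
  simp [takeW]

theorem prefixOf_iff_takeW {w : List (Fin n)} {χ : Cantor n} :
    PrefixOf w χ ↔ takeW χ w.length = w := by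
  constructor
  · intro h
    refine List.ext_getElem (length_takeW _ _) fun i h₁ h₂ => ?_
    rw [getElem_takeW, ← h i h₂, List.get_eq_getElem]
  · intro h i hi
    have h' : i < (takeW χ w.length).length := by rwa [length_takeW]
    rw [List.get_eq_getElem, ← getElem_takeW χ w.length i h']
    simp [h]

theorem prefixOf_takeW (χ : Cantor n) (k : ℕ) : PrefixOf (takeW χ k) χ := by
  rw [prefixOf_iff_takeW, length_takeW]

theorem appendInf_append (a b : List (Fin n)) (χ : Cantor n) :
    appendInf (a ++ b) χ = appendInf a (appendInf b χ) := by
  funext i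
  simp only [appendInf, List.length_append, List.get_eq_getElem]
  split_ifs with h₁ h₂ h₃ h₄ h₅
  · rw [List.getElem_append_left h₂]
  · rw [List.getElem_append_right (by omega)]
  · omega
  · omega
  · omega
  · congr 1
    omega

theorem appendInf_add_length (w : List (Fin n)) (χ : Cantor n) (i : ℕ) :
    appendInf w χ (i + w.length) = χ i := by
  simp [appendInf]

theorem appendInf_injective (w : List (Fin n)) :
    Function.Injective (appendInf w : Cantor n → Cantor n) := by
  intro a b h
  funext i
  rw [← appendInf_add_length w a i, h, appendInf_add_length]

theorem prefixOf_appendInf (w : List (Fin n)) (χ : Cantor n) :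
    PrefixOf w (appendInf w χ) := by
  intro i h
  simp [appendInf, h]

theorem PrefixOf.exists_eq_appendInf {w : List (Fin n)} {χ : Cantor n} (h : PrefixOf w χ) :
    ∃ χ', χ = appendInf w χ' := by
  refine ⟨fun i => χ (i + w.length), ?_⟩
  funext i
  by_cases hi : i < w.length
  · simp only [appendInf, hi, dif_pos]
    exact (h i hi).symm
  · simp only [appendInf, hi, dif_neg, not_false_eq_true]
    congr 1
    omega

theorem PrefixOf.append {a b : List (Fin n)} {χ : Cantor n} (h : PrefixOf b χ) :
    PrefixOf (a ++ b) (appendInf a χ) := by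
  obtain ⟨χ', rfl⟩ := h.exists_eq_appendInf
  rw [← appendInf_append]
  exact prefixOf_appendInf _ _

theorem takeW_add (χ : Cantor n) (a b : ℕ) :
    ∃ v : List (Fin n), v.length = b ∧ takeW χ (a + b) = takeW χ a ++ v := by
  refine ⟨List.ofFn fun i : Fin b => χ (a + i), by simp, ?_⟩
  simp only [takeW, List.ofFn_add]
  rfl

theorem takeW_appendInf (w : List (Fin n)) (χ : Cantor n) (k : ℕ) :
    takeW (appendInf w χ) (w.length + k) = w ++ takeW χ k := by
  have h := prefixOf_iff_takeW.1 ((prefixOf_takeW χ k).append (a := w))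
  rwa [List.length_append, length_takeW] at h

theorem PrefixOf.of_append {a b : List (Fin n)} {χ : Cantor n} (h : PrefixOf (a ++ b) χ) :
    PrefixOf a χ := by
  obtain ⟨χ', rfl⟩ := h.exists_eq_appendInf
  rw [appendInf_append]
  exact prefixOf_appendInf _ _

theorem PrefixOf.prefix_of_length_le {a b : List (Fin n)} {χ : Cantor n} (ha : PrefixOf a χ)
    (hb : PrefixOf b χ) (h : a.length ≤ b.length) : a <+: b := by
  obtain ⟨v, -, hv⟩ := takeW_add χ a.length (b.length - a.length)
  rw [Nat.add_sub_cancel' h, prefixOf_iff_takeW.1 ha, prefixOf_iff_takeW.1 hb] at hv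
  exact ⟨v, hv.symm⟩

theorem eq_of_common_prefixes {a b : Cantor n}
    (h : ∀ m : ℕ, ∃ w : List (Fin n), m ≤ w.length ∧ PrefixOf w a ∧ PrefixOf w b) : a = b := by
  funext i
  obtain ⟨w, hw, ha, hb⟩ := h (i + 1)
  rw [← ha i hw, ← hb i hw]

/-- If every infinite word with prefix `w` has prefix `v`, then `v` is a prefix of `w`. -/
theorem prefix_of_forall_prefixOf (hn : 2 ≤ n) {v w : List (Fin n)}
    (h : ∀ δ : Cantor n, PrefixOf v (appendInf w δ)) : v <+: w := by
  by_cases hl : v.length ≤ w.length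
  · exact (h fun _ => ⟨0, by omega⟩).prefix_of_length_le (prefixOf_appendInf _ _) hl
  · push Not at hl
    have h₀ := h (fun _ => ⟨0, by omega⟩) w.length hl
    have h₁ := h (fun _ => ⟨1, by omega⟩) w.length hl
    rw [h₀] at h₁
    simp [appendInf] at h₁

theorem IsLCP.exists_of_ne {A : Set (Cantor n)} {a b : Cantor n} (ha : a ∈ A) (hb : b ∈ A)
    (hab : a ≠ b) : ∃ l, IsLCP A l := by
  obtain ⟨i, hi⟩ := Function.ne_iff.1 hab
  have hbound : ∀ l : List (Fin n), (∀ ρ ∈ A, PrefixOf l ρ) → l.length ≤ i := by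
    intro l hl
    by_contra! hlt
    exact hi ((hl a ha i hlt).symm.trans (hl b hb i hlt))
  let P : ℕ → Prop := fun k => ∃ l : List (Fin n), (∀ ρ ∈ A, PrefixOf l ρ) ∧ l.length = k
  have h₀ : P 0 := ⟨[], fun _ _ j hj => absurd hj (Nat.not_lt_zero j), rfl⟩
  obtain ⟨l, hl, hlen⟩ := Nat.findGreatest_spec (Nat.zero_le i) h₀
  refine ⟨l, hl, fun l' hl' => ?_⟩
  rw [hlen]
  exact Nat.le_findGreatest (hbound l' hl') ⟨l', hl', rfl⟩

theorem isOpen_cone (w : List (Fin n)) : IsOpen (cone w) := by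
  have : (cone w : Set (Cantor n)) =
      ⋂ i : Fin w.length, (fun χ : Cantor n => χ i) ⁻¹' {w.get i} := by
    ext χ
    simp [cone, PrefixOf, Fin.forall_iff, eq_comm]
  rw [this]
  exact isOpen_iInter_of_finite fun i => (isOpen_discrete _).preimage (continuous_apply _)

theorem exists_takeW_cone_subset {U : Set (Cantor n)} (hU : IsOpen U) {x : Cantor n}
    (hx : x ∈ U) : ∃ k : ℕ, cone (takeW x k) ⊆ U := by
  obtain ⟨V, ⟨y, k, rfl⟩, hxV, hVU⟩ :=
    (PiNat.isTopologicalBasis_cylinders fun _ => Fin n).exists_subset_of_mem_open hx hU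
  refine ⟨k, fun z hz => hVU fun i hi => ?_⟩
  rw [← hxV i hi, ← getElem_takeW x k i (by rwa [length_takeW])]
  exact (hz i (by rwa [length_takeW])).symm

end Words

namespace Transducer

variable {n : ℕ}

theorem outStar_append (T : Transducer n) (a b : List (Fin n)) (q : T.Q) :
    T.outStar (a ++ b) q = T.outStar a q ++ T.outStar b (T.transStar a q) := by
  induction a generalizing q with
  | nil => rfl
  | cons x a ih => simp [outStar, transStar, ih]

theorem outStar_prod (T S : Transducer n) (w : List (Fin n)) (q : T.Q) (s : S.Q) :
    (T.prod S).outStar w (q, s) = S.outStar (T.outStar w q) s := by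
  induction w generalizing q s with
  | nil => rfl
  | cons x w ih =>
    change S.outStar (T.out x q) s ++
      (T.prod S).outStar w (T.tr x q, S.transStar (T.out x q) s) = _
    rw [ih, outStar, outStar_append]

theorem Induces.prefixOf {T : Transducer n} {q : T.Q} {f : Cantor n → Cantor n}
    (h : T.Induces q f) {w : List (Fin n)} {χ : Cantor n} (hw : PrefixOf w χ) :
    PrefixOf (T.outStar w q) (f χ) := by
  obtain ⟨k, hk, hp⟩ := h χ (T.outStar w q).length
  rcases le_total w.length k with hle | hle
  · obtain ⟨v, hv⟩ := hw.prefix_of_length_le (prefixOf_takeW χ k) (by rwa [length_takeW])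
    rw [← hv, outStar_append] at hp
    exact hp.of_append
  · obtain ⟨v, rfl⟩ := (prefixOf_takeW χ k).prefix_of_length_le hw (by rwa [length_takeW])
    rw [outStar_append] at hk ⊢
    rw [List.length_append] at hk
    have : T.outStar v (T.transStar (takeW χ k) q) = [] :=
      List.length_eq_zero_iff.1 (by omega)
    rwa [this, List.append_nil]

theorem Induces.eq {T : Transducer n} {q : T.Q} {f : Cantor n → Cantor n}
    (h : T.Induces q f) {χ y : Cantor n}
    (hy : ∀ w, PrefixOf w χ → PrefixOf (T.outStar w q) y) : f χ = y := by
  refine eq_of_common_prefixes fun m => ?_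
  obtain ⟨k, hk, hp⟩ := h χ m
  exact ⟨_, hk, hp, hy _ (prefixOf_takeW χ k)⟩

theorem Induces.unique {T : Transducer n} {q : T.Q} {f g : Cantor n → Cantor n}
    (hf : T.Induces q f) (hg : T.Induces q g) : f = g :=
  funext fun _ => hf.eq fun _ hw => hg.prefixOf hw

theorem Induces.apply_appendInf {T : Transducer n} {q : T.Q} {w : List (Fin n)}
    {f g : Cantor n → Cantor n} (hf : T.Induces q f) (hg : T.Induces (T.transStar w q) g)
    (χ : Cantor n) : f (appendInf w χ) = appendInf (T.outStar w q) (g χ) := by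
  refine eq_of_common_prefixes fun m => ?_
  obtain ⟨k, hk, hp⟩ := hg χ m
  refine ⟨T.outStar (w ++ takeW χ k) q, ?_, hf.prefixOf (prefixOf_takeW χ k).append, ?_⟩
  · rw [outStar_append, List.length_append]
    omega
  · rw [outStar_append]
    exact hp.append

theorem Induces.prod {T S : Transducer n} {q : T.Q} {s : S.Q} {f g F : Cantor n → Cantor n}
    (hf : T.Induces q f) (hg : S.Induces s g) (hF : (T.prod S).Induces (q, s) F) (χ : Cantor n) :
    F χ = g (f χ) := by
  refine hF.eq fun w hw => ?_
  rw [outStar_prod]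
  exact hg.prefixOf (hf.prefixOf hw)

theorem PartiallyInvertible.induces {T : Transducer n} (h : T.PartiallyInvertible) (q : T.Q) :
    T.Induces q (T.inducedMap q) := by
  have hq : ∃ f, T.Induces q f := (h q).imp fun _ hf => hf.1
  rw [inducedMap, dif_pos hq]
  exact hq.choose_spec

theorem PartiallyInvertible.injective {T : Transducer n} (h : T.PartiallyInvertible) (q : T.Q) :
    Function.Injective (T.inducedMap q) := by
  obtain ⟨f, hf, hinj, -⟩ := h q
  rwa [(h.induces q).unique hf]

theorem PartiallyInvertible.isOpen_range {T : Transducer n} (h : T.PartiallyInvertible)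
    (q : T.Q) : IsOpen (Set.range (T.inducedMap q)) := by
  obtain ⟨f, hf, -, hcl⟩ := h q
  rw [(h.induces q).unique hf]
  exact hcl.isOpen

theorem PartiallyInvertible.stateImage_eq {T : Transducer n} (h : T.PartiallyInvertible)
    (q : T.Q) : T.stateImage q = Set.range (T.inducedMap q) := by
  ext y
  constructor
  · rintro ⟨f, χ, hf, rfl⟩
    exact ⟨χ, by rw [(h.induces q).unique hf]⟩
  · rintro ⟨χ, rfl⟩
    exact ⟨_, χ, h.induces q, rfl⟩

theorem PartiallyInvertible.isLCP_lcp {T : Transducer n} (hn : 2 ≤ n)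
    (h : T.PartiallyInvertible) {q : T.Q} {w : List (Fin n)}
    (hw : cone w ⊆ T.stateImage q) :
    IsLCP {ρ : Cantor n | T.inducedMap q ρ ∈ cone w} (T.lcp q w) := by
  rw [h.stateImage_eq] at hw
  obtain ⟨a, ha⟩ := hw (prefixOf_appendInf w fun _ => ⟨0, by omega⟩)
  obtain ⟨b, hb⟩ := hw (prefixOf_appendInf w fun _ => ⟨1, by omega⟩)
  have hex : ∃ l, IsLCP {ρ : Cantor n | T.inducedMap q ρ ∈ cone w} l := by
    refine IsLCP.exists_of_ne (a := a) (b := b) ?_ ?_ ?_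
    · rw [Set.mem_ofPred_eq, ha]
      exact prefixOf_appendInf _ _
    · rw [Set.mem_ofPred_eq, hb]
      exact prefixOf_appendInf _ _
    · rintro rfl
      have := congrFun (appendInf_injective w (ha.symm.trans hb)) 0
      simp at this
  rw [lcp, dif_pos hex]
  exact hex.choose_spec

/-- The state of the inversion algorithm obtained from `(w, q)` by writing out the forced
output `𝓛_q(w)`. -/
def reducedPair (T : Transducer n) (w : List (Fin n)) (q : T.Q) : List (Fin n) × T.Q :=
  (w.drop (T.outStar (T.lcp q w) q).length, T.transStar (T.lcp q w) q)

theorem PartiallyInvertible.outStar_lcp_prefix {T : Transducer n} (hn : 2 ≤ n)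
    (h : T.PartiallyInvertible) {q : T.Q} {w : List (Fin n)}
    (hw : cone w ⊆ T.stateImage q) :
    T.outStar (T.lcp q w) q ++ (T.reducedPair w q).1 = w := by
  have hl := h.isLCP_lcp hn hw
  have hpre : T.outStar (T.lcp q w) q <+: w := by
    refine prefix_of_forall_prefixOf hn fun δ => ?_
    have hδ := hw (prefixOf_appendInf w δ)
    rw [h.stateImage_eq] at hδ
    obtain ⟨a, ha⟩ := hδ
    rw [← ha]
    refine (h.induces q).prefixOf (hl.1 a ?_)
    rw [Set.mem_ofPred_eq, ha]
    exact prefixOf_appendInf _ _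
  exact List.prefix_iff_eq_append.1 hpre

theorem PartiallyInvertible.inducedMap_appendInf {T : Transducer n}
    (h : T.PartiallyInvertible) (q : T.Q) (w : List (Fin n)) (χ : Cantor n) :
    T.inducedMap q (appendInf w χ) =
      appendInf (T.outStar w q) (T.inducedMap (T.transStar w q) χ) :=
  (h.induces q).apply_appendInf (h.induces _) χ

theorem PartiallyInvertible.exists_of_inducedMap_eq {T : Transducer n} (hn : 2 ≤ n)
    (h : T.PartiallyInvertible) {q : T.Q} {w : List (Fin n)} (hw : cone w ⊆ T.stateImage q)
    {χ δ : Cantor n} (hχ : T.inducedMap q χ = appendInf w δ) :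
    ∃ χ', χ = appendInf (T.lcp q w) χ' ∧
      T.inducedMap (T.reducedPair w q).2 χ' = appendInf (T.reducedPair w q).1 δ := by
  have hpre : PrefixOf (T.lcp q w) χ := by
    refine (h.isLCP_lcp hn hw).1 χ ?_
    rw [Set.mem_ofPred_eq, hχ]
    exact prefixOf_appendInf _ _
  obtain ⟨χ', rfl⟩ := hpre.exists_eq_appendInf
  refine ⟨χ', rfl, appendInf_injective (T.outStar (T.lcp q w) q) ?_⟩
  rw [← appendInf_append, h.outStar_lcp_prefix hn hw, ← hχ]
  exact (h.inducedMap_appendInf _ _ _).symm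

theorem PartiallyInvertible.goodPair_reducedPair {T : Transducer n} (hn : 2 ≤ n)
    (h : T.PartiallyInvertible) {q : T.Q} {w : List (Fin n)}
    (hw : cone w ⊆ T.stateImage q) : T.GoodPair (T.reducedPair w q) := by
  constructor
  · intro y hy
    obtain ⟨δ, rfl⟩ := PrefixOf.exists_eq_appendInf hy
    have hδ := hw (prefixOf_appendInf w δ)
    rw [h.stateImage_eq] at hδ ⊢
    obtain ⟨χ, hχ⟩ := hδ
    obtain ⟨χ', -, h'⟩ := h.exists_of_inducedMap_eq hn hw hχ
    exact ⟨χ', h'⟩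
  · refine ⟨fun _ _ j hj => absurd hj (Nat.not_lt_zero j), fun l' hl' => ?_⟩
    have hle := (h.isLCP_lcp hn hw).2 (T.lcp q w ++ l') ?_
    · rw [List.length_append] at hle
      simp only [List.length_nil]
      omega
    · intro χ hχ
      obtain ⟨δ, hδ⟩ := PrefixOf.exists_eq_appendInf hχ
      obtain ⟨χ', rfl, h'⟩ := h.exists_of_inducedMap_eq hn hw hδ
      refine (hl' χ' ?_).append
      rw [Set.mem_ofPred_eq, h']
      exact prefixOf_appendInf _ _

theorem cone_append_subset (a b : List (Fin n)) : cone (a ++ b) ⊆ cone a :=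
  fun _ h => PrefixOf.of_append h

theorem PartiallyInvertible.prefixOf_outStar_partialInv {T : Transducer n} (hn : 2 ≤ n)
    (h : T.PartiallyInvertible) (v : List (Fin n)) (s : T.partialInv.Q) {δ χ : Cantor n}
    (hv : PrefixOf v δ) (hχ : T.inducedMap s.1.2 χ = appendInf s.1.1 δ) :
    PrefixOf (T.partialInv.outStar v s) χ := by
  induction v generalizing s δ χ with
  | nil => exact fun j hj => absurd hj (Nat.not_lt_zero j)
  | cons x v ih =>
    have hsub : cone (s.1.1 ++ [x]) ⊆ T.stateImage s.1.2 :=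
      (cone_append_subset _ _).trans s.2.1
    have hgood := h.goodPair_reducedPair hn hsub
    have htr : T.partialInv.tr x s = ⟨T.reducedPair (s.1.1 ++ [x]) s.1.2, hgood⟩ :=
      dif_pos hgood
    obtain ⟨δ', rfl⟩ := hv.exists_eq_appendInf
    rw [← List.singleton_append, appendInf_append, ← appendInf_append] at hχ
    obtain ⟨χ', rfl, h'⟩ := h.exists_of_inducedMap_eq hn hsub hχ
    change PrefixOf (T.lcp s.1.2 (s.1.1 ++ [x]) ++ T.partialInv.outStar v (T.partialInv.tr x s)) _
    rw [htr]
    exact (ih ⟨_, hgood⟩ (prefixOf_appendInf v δ') h').append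

/-- Every state of the partial inverse of `T` undoes the corresponding state of `T`. -/
theorem PartiallyInvertible.inducedMap_partialInv {T : Transducer n} (hn : 2 ≤ n)
    (h : T.PartiallyInvertible) (s : T.partialInv.Q) {F : Cantor n → Cantor n}
    (hF : T.partialInv.Induces s F) {χ δ : Cantor n}
    (hχ : T.inducedMap s.1.2 χ = appendInf s.1.1 δ) : F δ = χ :=
  hF.eq fun _ hw => h.prefixOf_outStar_partialInv hn _ s hw hχ

/-- Near every point, `h` acts by replacing a prefix and applying a state of `T`. -/
def LocallyActs (T : Transducer n) (h : Cantor n → Cantor n) : Prop :=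
  ∀ x : Cantor n, ∃ (η ρ : List (Fin n)) (p : T.Q), PrefixOf η x ∧
    ∀ χ : Cantor n, h (appendInf η χ) = appendInf ρ (T.inducedMap p χ)

theorem PartiallyInvertible.apply_appendInf_append {T : Transducer n} (hPI : T.PartiallyInvertible)
    {h : Cantor n → Cantor n} {η ρ : List (Fin n)} {p : T.Q}
    (hh : ∀ χ : Cantor n, h (appendInf η χ) = appendInf ρ (T.inducedMap p χ))
    (v : List (Fin n)) (χ : Cantor n) :
    h (appendInf (η ++ v) χ) =
      appendInf (ρ ++ T.outStar v p) (T.inducedMap (T.transStar v p) χ) := by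
  rw [appendInf_append, hh, hPI.inducedMap_appendInf, appendInf_append]

theorem IsCompletion.locallyActs {T : Transducer n} (hPI : T.PartiallyInvertible)
    {h : Cantor n ≃ₜ Cantor n} (hh : T.IsCompletion h) : T.LocallyActs h := by
  obtain ⟨l, η, ρ, p, f, -, hη, hf, -, -, hact⟩ := hh
  intro x
  obtain ⟨i, hi, -⟩ := hη x
  refine ⟨η i, ρ i, p i, hi, fun χ => ?_⟩
  rw [hact, (hf i).unique (hPI.induces _)]

theorem LocallyActs.exists_uniform {T : Transducer n} (hn : 2 ≤ n)
    (hPI : T.PartiallyInvertible) {h : Cantor n → Cantor n} (hh : T.LocallyActs h) :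
    ∃ K : ℕ, ∀ w : List (Fin n), w.length = K → ∃ (ρ : List (Fin n)) (p : T.Q),
      ∀ χ : Cantor n, h (appendInf w χ) = appendInf ρ (T.inducedMap p χ) := by
  choose η ρ p hη hact using hh
  obtain ⟨t, ht⟩ := isCompact_univ.elim_finite_subcover (fun x => cone (η x))
    (fun x => isOpen_cone _) fun x _ => Set.mem_iUnion.2 ⟨x, hη x⟩
  refine ⟨t.sup fun x => (η x).length, fun w hw => ?_⟩
  have hmem := ht (Set.mem_univ (appendInf w fun _ => ⟨0, by omega⟩))
  simp only [Set.mem_iUnion] at hmem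
  obtain ⟨x, hx, hxw⟩ := hmem
  have hle : (η x).length ≤ w.length :=
    hw ▸ Finset.le_sup (f := fun x => (η x).length) hx
  obtain ⟨v, rfl⟩ := PrefixOf.prefix_of_length_le hxw (prefixOf_appendInf _ _) hle
  exact ⟨_, _, hPI.apply_appendInf_append (hact x) v⟩

theorem LocallyActs.isCompletion {T : Transducer n} (hn : 2 ≤ n)
    (hPI : T.PartiallyInvertible) {h : Cantor n ≃ₜ Cantor n} (hh : T.LocallyActs h) :
    T.IsCompletion h := by
  obtain ⟨K, hK⟩ := hh.exists_uniform hn hPI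
  let e : Fin (n ^ K) ≃ (Fin K → Fin n) := finFunctionFinEquiv.symm
  let η : Fin (n ^ K) → List (Fin n) := fun i => List.ofFn (e i)
  have hη : AntichainFam η := by
    intro χ
    refine ⟨e.symm fun i => χ i, ?_, fun j hj => ?_⟩
    · simp only [η, Equiv.apply_symm_apply]
      exact prefixOf_takeW χ K
    · rw [Equiv.eq_symm_apply]
      have hj' := prefixOf_iff_takeW.1 hj
      rw [List.length_ofFn] at hj'
      exact (List.ofFn_injective hj').symm
  choose ρ p hact using fun i => hK (η i) (List.length_ofFn)
  refine ⟨n ^ K, η, ρ, p, fun i => T.inducedMap (p i), ?_, hη, fun i => hPI.induces _, ?_, ?_,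
    hact⟩
  · have h₁ : n ≡ 1 [MOD n - 1] :=
      ((Nat.modEq_iff_dvd' (by omega)).2 dvd_rfl).symm
    have h₂ := h₁.pow K
    rwa [one_pow] at h₂
  · refine Set.eq_univ_of_forall fun y => ?_
    obtain ⟨x, rfl⟩ := h.surjective y
    obtain ⟨i, hi, -⟩ := hη x
    obtain ⟨χ, rfl⟩ := PrefixOf.exists_eq_appendInf hi
    rw [hact]
    exact Set.mem_iUnion.2 ⟨i, _, ⟨χ, rfl⟩, rfl⟩
  · intro i j hij
    rw [Set.disjoint_left]
    rintro _ ⟨_, ⟨χ, rfl⟩, rfl⟩ ⟨_, ⟨χ', rfl⟩, heq⟩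
    rw [← hact, ← hact] at heq
    have := h.injective heq
    refine hij ((hη _).unique (prefixOf_appendInf (η i) χ) ?_)
    rw [← this]
    exact prefixOf_appendInf _ _

theorem LocallyActs.of_locallyAgrees {T : Transducer n} (hPI : T.PartiallyInvertible)
    {G : Set (Cantor n ≃ₜ Cantor n)} (hG : ∀ g ∈ G, T.LocallyActs g)
    {f : Cantor n ≃ₜ Cantor n} (hf : LocallyAgrees G f) : T.LocallyActs f := by
  intro x
  obtain ⟨U, hU, hxU, g, hg, heq⟩ := hf x
  obtain ⟨k, hk⟩ := exists_takeW_cone_subset hU hxU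
  obtain ⟨η, ρ, p, hη, hact⟩ := hG g hg x
  obtain ⟨χ, rfl⟩ := hη.exists_eq_appendInf
  refine ⟨η ++ takeW χ k, ρ ++ T.outStar (takeW χ k) p, T.transStar (takeW χ k) p,
    (prefixOf_takeW χ k).append, fun χ' => ?_⟩
  rw [heq (hk ?_), hPI.apply_appendInf_append hact]
  obtain ⟨v, -, hv⟩ := takeW_add (appendInf η χ) k η.length
  rw [← takeW_appendInf, add_comm, hv]
  exact (prefixOf_appendInf _ _).of_append

theorem Contracting.exists_induces {T : Transducer n} (hcontr : T.Contracting) {L : List Bool}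
    (hL : L ≠ []) {W : Transducer n} (hW : T.prodOf L = W) (q : W.Q) :
    ∃ F, W.Induces q F := by
  subst hW
  obtain ⟨-, -, F, hF, -⟩ := hcontr L hL q
  exact ⟨F, hF⟩

/-- If `F` is induced by a state of a product of copies of `T` and its partial inverse, where
`T` is contracting, then `h` acts locally as `T` wherever it acts locally as `F`. -/
theorem Contracting.exists_local {T : Transducer n} (hPI : T.PartiallyInvertible)
    (hcontr : T.Contracting) {L : List Bool} (hL : L ≠ []) {W : Transducer n}
    (hW : T.prodOf L = W) {q : W.Q} {F h : Cantor n → Cantor n} (hF : W.Induces q F)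
    {η ρ : List (Fin n)} {x : Cantor n} (hη : PrefixOf η x)
    (hact : ∀ χ : Cantor n, h (appendInf η χ) = appendInf ρ (F χ)) :
    ∃ (η ρ : List (Fin n)) (p : T.Q), PrefixOf η x ∧
      ∀ χ : Cantor n, h (appendInf η χ) = appendInf ρ (T.inducedMap p χ) := by
  subst hW
  obtain ⟨V, p, f, hf, hVf, j, hj⟩ := hcontr L hL q
  obtain rfl := hF.unique hf
  obtain ⟨χ, rfl⟩ := hη.exists_eq_appendInf
  obtain ⟨u, g, hVg, hTg⟩ := hj (takeW χ j) (length_takeW χ j)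
  refine ⟨η ++ takeW χ j, ρ ++ V.outStar (takeW χ j) p, u, (prefixOf_takeW χ j).append,
    fun χ' => ?_⟩
  rw [appendInf_append, hact, hVf.apply_appendInf hVg, appendInf_append,
    hTg.unique (hPI.induces u)]

theorem LocallyActs.comp {T : Transducer n} (hPI : T.PartiallyInvertible)
    (hcontr : T.Contracting) {g h : Cantor n → Cantor n} (hg : T.LocallyActs g)
    (hh : T.LocallyActs h) : T.LocallyActs (g ∘ h) := by
  intro x
  obtain ⟨η, ρ, p, hη, hact⟩ := hh x
  obtain ⟨η', ρ', p', hη', hact'⟩ := hg (h x)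
  obtain ⟨χ, rfl⟩ := hη.exists_eq_appendInf
  obtain ⟨k, hk, hpre⟩ := hPI.induces p χ η'.length
  have hact₂ := hPI.apply_appendInf_append hact (takeW χ k)
  have hpre₂ : PrefixOf (ρ ++ T.outStar (takeW χ k) p) (h (appendInf η χ)) := by
    rw [hact]
    exact hpre.append
  obtain ⟨σ, hσ⟩ := hη'.prefix_of_length_le hpre₂ (by rw [List.length_append]; omega)
  have hprod : T.prodOf [true, true] = T.prod T := by simp [prodOf, factor]
  obtain ⟨F, hF⟩ := hcontr.exists_induces (by simp) hprod
    (T.transStar (takeW χ k) p, T.transStar σ p')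
  refine hcontr.exists_local hPI (by simp) hprod hF (η := η ++ takeW χ k)
    (ρ := ρ' ++ T.outStar σ p') (prefixOf_takeW χ k).append fun χ' => ?_
  rw [Function.comp_apply, hact₂, ← hσ, hPI.apply_appendInf_append hact',
    (hPI.induces _).prod (hPI.induces _) hF]

theorem LocallyActs.symm {T : Transducer n} (hn : 2 ≤ n) (hPI : T.PartiallyInvertible)
    (hcontr : T.Contracting) {h : Cantor n ≃ₜ Cantor n} (hh : T.LocallyActs h) :
    T.LocallyActs h.symm := by
  intro y
  obtain ⟨η, ρ, p, hη, hact⟩ := hh (h.symm y)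
  obtain ⟨χ, hχ⟩ := hη.exists_eq_appendInf
  have hy : y = appendInf ρ (T.inducedMap p χ) := by
    rw [← hact, ← hχ, h.apply_symm_apply]
  obtain ⟨k, hk⟩ := exists_takeW_cone_subset (hPI.isOpen_range p) (Set.mem_range_self χ)
  set w := takeW (T.inducedMap p χ) k
  rw [← hPI.stateImage_eq] at hk
  have hgood := hPI.goodPair_reducedPair hn hk
  let s : T.partialInv.Q := ⟨T.reducedPair w p, hgood⟩
  have hprod : T.prodOf [false] = T.partialInv := by simp [prodOf, factor]
  obtain ⟨F, hF⟩ := hcontr.exists_induces (by simp) hprod s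
  refine hcontr.exists_local hPI (by simp) hprod hF (η := ρ ++ w)
    (ρ := η ++ T.lcp p w) ?_ fun δ => ?_
  · rw [hy]
    exact (prefixOf_takeW _ k).append
  · have hδ := hk (prefixOf_appendInf w δ)
    rw [hPI.stateImage_eq] at hδ
    obtain ⟨χ₁, hχ₁⟩ := hδ
    obtain ⟨χ₂, rfl, h₂⟩ := hPI.exists_of_inducedMap_eq hn hk hχ₁
    rw [hPI.inducedMap_partialInv hn s hF h₂, h.symm_apply_eq, appendInf_append,
      appendInf_append, hact, hχ₁]

theorem LocallyActs.of_mem_HGroup {T : Transducer n} (hn : 2 ≤ n) (hPI : T.PartiallyInvertible)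
    (hcontr : T.Contracting) (hex : ∃ h : Cantor n ≃ₜ Cantor n, T.IsCompletion h)
    {g : Cantor n ≃ₜ Cantor n} (hg : g ∈ T.HGroup) : T.LocallyActs g := by
  induction hg using Subgroup.closure_induction with
  | mem g hg => exact hg.locallyActs hPI
  | one =>
    obtain ⟨h, hh⟩ := hex
    have hl := hh.locallyActs hPI
    have hc := (hl.symm hn hPI hcontr).comp hPI hcontr hl
    rwa [h.symm_comp_self] at hc
  | mul a b _ _ ha hb => exact ha.comp hPI hcontr hb
  | inv a _ ha => exact ha.symm hn hPI hcontr

end Transducer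

/-- Theorem 6.15. Let `T ∈ 𝔓ₙ` be a contracting transducer with at
least one completion in the homeomorphism group of Cantor space.  Then
`𝓗(T) = 𝓕(T)`: every homeomorphism of Cantor space that locally agrees with `𝓗(T)` is
itself a completion of `T`, hence lies in `𝓗(T)`. -/
theorem HGroup_eq_FGroup_of_contracting
    {n : ℕ} (hn : 2 ≤ n) (T : Transducer n) [Finite T.Q]
    (hPI : T.PartiallyInvertible) (hcontr : T.Contracting)
    (hex : ∃ h : Cantor n ≃ₜ Cantor n, T.IsCompletion h) :
    (∀ f : Cantor n ≃ₜ Cantor n,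
      LocallyAgrees (↑(Transducer.HGroup T)) f → T.IsCompletion f) ∧
    {f : Cantor n ≃ₜ Cantor n | LocallyAgrees (↑(Transducer.HGroup T)) f} =
      ↑(Transducer.HGroup T) := by
  have hloc : ∀ f : Cantor n ≃ₜ Cantor n,
      LocallyAgrees (↑(Transducer.HGroup T)) f → T.IsCompletion f := fun f hf =>
    (Transducer.LocallyActs.of_locallyAgrees hPI
      (fun _ hg => Transducer.LocallyActs.of_mem_HGroup hn hPI hcontr hex hg) hf).isCompletion
        hn hPI
  refine ⟨hloc, Set.Subset.antisymm (fun f hf => Subgroup.subset_closure (hloc f hf)) ?_⟩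
  exact fun f hf x => ⟨Set.univ, isOpen_univ, Set.mem_univ x, f, hf, Set.eqOn_refl _ _⟩
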